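/- arXiv:0908.0077 — 6 statements merged into one kernel-verified Lean document; each statement's English description precedes it below -/
import Mathlib

section
/- Assume (H1) and (H2), and let R = 1/min_{m∈B,i∈A} q(m|i). Suppose λ1 ≥ λ2 ≥ … ≥ λk are real numbers (the Lyapunov exponents listed with multiplicity) such that Σ_{i=1}^{k} λ_i = ∫_{B^ℤ} log |det L_z| dμ(z) and such that for μ-almost every z, lim_{n→∞} (1/n) log ‖L_z^{[n]} 𝟙‖ = λ1. Then λ2 − λ1 ≥ (1/(k−1)) log |det p| − (k/(k−1)) log R. -/
open Filter MeasureTheory Matrix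

noncomputable section

/-- The left shift on bi-infinite sequences: `(shift z) n = z (n+1)`. -/
def shift {l : ℕ} (z : ℤ → Fin l) : ℤ → Fin l := fun n => z (n + 1)

/-- The inverse shift: `(invShift z) n = z (n-1)`. -/
def invShift {l : ℕ} (z : ℤ → Fin l) : ℤ → Fin l := fun n => z (n - 1)

/-- The matrix `(L_z)_{i,j} = q(z_0 | j) * p(j | i)`, where `p i j = p(j|i)` and `q i m = q(m|i)`. -/
def Lmat {k l : ℕ} (p : Matrix (Fin k) (Fin k) ℝ) (q : Matrix (Fin k) (Fin l) ℝ)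
    (z : ℤ → Fin l) : Matrix (Fin k) (Fin k) ℝ :=
  Matrix.of fun i j => q j (z 0) * p i j

/-- `Lpow p q n z = L_{S^{-(n-1)}z} ⋯ L_{S^{-1}z} L_z` (and `= 1` for `n = 0`). -/
def Lpow {k l : ℕ} (p : Matrix (Fin k) (Fin k) ℝ) (q : Matrix (Fin k) (Fin l) ℝ) :
    ℕ → (ℤ → Fin l) → Matrix (Fin k) (Fin k) ℝ
  | 0, _ => 1
  | n + 1, z => Lmat p q (invShift^[n] z) * Lpow p q n z

/-- Euclidean norm on `ℝ^k`. -/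
def enorm2 {k : ℕ} (v : Fin k → ℝ) : ℝ := Real.sqrt (∑ i, v i ^ 2)

/-- The path sum `S^{[n]}_{a,b}(z)`; for `n = m+1 ≥ 1` the sum is over paths
`x : Fin (m+1) → Fin k`, where `x i` stands for `x_{-(n-i)}`. -/
def Spath {k l : ℕ} (p : Matrix (Fin k) (Fin k) ℝ) (q : Matrix (Fin k) (Fin l) ℝ)
    (piv : Fin k → ℝ) : ℕ → Fin k → Fin l → (ℤ → Fin l) → ℝ
  | 0, _, _, _ => 0
  | m + 1, a, b, z =>
      ∑ x : Fin (m + 1) → Fin k,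
        piv (x 0) * q (x 0) b * p (x (Fin.last m)) a *
          ∏ j : Fin m,
            q (x j.succ) (z (((j : ℕ) : ℤ) - (m : ℤ))) * p (x j.castSucc) (x j.succ)

/-- `Δ^{[n]}_{a,b,c}(z)`. -/
def Del {k l : ℕ} (p : Matrix (Fin k) (Fin k) ℝ) (q : Matrix (Fin k) (Fin l) ℝ)
    (piv : Fin k → ℝ) (n : ℕ) (a : Fin k) (b c : Fin l) (z : ℤ → Fin l) : ℝ :=
  Spath p q piv n a b z / (∑ a' : Fin k, Spath p q piv n a' b z)
    - Spath p q piv n a c z / (∑ a' : Fin k, Spath p q piv n a' c z)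

/-- `τ_z(a,b,c) = limsup_n (1/n) log |Δ^{[n]}_{a,b,c}(z)|`. -/
def tau {k l : ℕ} (p : Matrix (Fin k) (Fin k) ℝ) (q : Matrix (Fin k) (Fin l) ℝ)
    (piv : Fin k → ℝ) (z : ℤ → Fin l) (a : Fin k) (b c : Fin l) : ℝ :=
  Filter.limsup (fun n : ℕ => Real.log |Del p q piv n a b c z| / n) Filter.atTop

/-- `μ` is the law of the hidden Markov chain with transitions `p`, emissions `q`
and initial (invariant) law `piv`: cylinder probabilities. -/
def IsHMMLaw {k l : ℕ} (p : Matrix (Fin k) (Fin k) ℝ) (q : Matrix (Fin k) (Fin l) ℝ)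
    (piv : Fin k → ℝ) (μ : Measure (ℤ → Fin l)) : Prop :=
  ∀ (m : ℤ) (n : ℕ) (w : ℕ → Fin l),
    μ {z | ∀ t : ℕ, t ≤ n → z (m + t) = w t} =
      ENNReal.ofReal (∑ x : Fin (n + 1) → Fin k,
        piv (x 0) * q (x 0) (w 0) *
          ∏ j : Fin n, p (x j.castSucc) (x j.succ) * q (x j.succ) (w (j + 1)))


/-- **Proposition (lower bound on the gap).** Under (H1)-(H2), with
`R = 1 / min_{m,i} q(m|i)`, if `λ₁ ≥ λ₂ ≥ … ≥ λ_k` are the Lyapunov exponents (with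
multiplicity), so that their sum is `∫ log |det L_z| dμ(z)` and `λ₁` is the a.s.
exponential growth rate of `‖L_z^{[n]} 𝟙‖`, then
`λ₂ - λ₁ ≥ (1/(k-1)) log |det p| - (k/(k-1)) log R`. -/
theorem gap_lower_bound
    (k l : ℕ) (hk : 2 ≤ k) (hkl : k ≤ l)
    (p : Matrix (Fin k) (Fin k) ℝ) (q : Matrix (Fin k) (Fin l) ℝ)
    (hp_row : ∀ i, ∑ j, p i j = 1)
    (hq_row : ∀ i, ∑ m, q i m = 1)
    -- Hypothesis (H1)
    (hH1p : ∀ i j, 0 < p i j)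
    (hH1q : ∀ i m, 0 < q i m)
    -- Hypothesis (H2)
    (hH2p : p.det ≠ 0)
    (hH2q : q.rank = k)
    -- invariant probability vector
    (piv : Fin k → ℝ)
    (hpiv_nonneg : ∀ i, 0 ≤ piv i)
    (hpiv_sum : ∑ i, piv i = 1)
    (hpiv_inv : ∀ j, ∑ i, piv i * p i j = piv j)
    -- the hidden Markov measure
    (μ : Measure (ℤ → Fin l)) [IsProbabilityMeasure μ]
    (herg : Ergodic shift μ)
    (hlaw : IsHMMLaw p q piv μ)
    -- `R = 1 / min_{m ∈ B, i ∈ A} q(m|i)`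
    (R : ℝ)
    (hR : R = 1 / sInf {x : ℝ | ∃ (i : Fin k) (m : Fin l), q i m = x})
    -- the Lyapunov exponents, listed with multiplicity in nonincreasing order
    (lam : Fin k → ℝ)
    (hlam_mono : Antitone lam)
    (hlam_sum : ∑ i, lam i = ∫ z, Real.log |(Lmat p q z).det| ∂μ)
    (hlam_top : ∀ᵐ z ∂μ,
      Tendsto
        (fun n : ℕ => Real.log (enorm2 ((Lpow p q n z).mulVec fun _ => (1 : ℝ))) / n)
        atTop (nhds (lam ⟨0, by omega⟩))) :
    lam ⟨1, by omega⟩ - lam ⟨0, by omega⟩ ≥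
      (1 / (k - 1 : ℝ)) * Real.log |p.det| - ((k : ℝ) / (k - 1 : ℝ)) * Real.log R := by
  have hk1 : (0 : ℝ) < (k : ℝ) - 1 := by
    have : (2 : ℝ) ≤ k := by exact_mod_cast hk
    linarith
  -- the minimum of the emission probabilities
  set S : Set ℝ := {x : ℝ | ∃ (i : Fin k) (m : Fin l), q i m = x} with hS
  have hSfin : S.Finite := by
    have : S = Set.range (fun im : Fin k × Fin l => q im.1 im.2) := by
      ext x
      simp [hS]
    rw [this]
    exact Set.finite_range _
  have hSne : S.Nonempty := ⟨q ⟨0, by omega⟩ ⟨0, by omega⟩, _, _, rfl⟩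
  have hmpos : 0 < sInf S := by
    obtain ⟨i, m, h⟩ := hSne.csInf_mem hSfin
    rw [← h]
    exact hH1q i m
  have hmle : ∀ i m, sInf S ≤ q i m := fun i m => csInf_le hSfin.bddBelow ⟨i, m, rfl⟩
  have hlogR : Real.log R = - Real.log (sInf S) := by
    rw [hR, one_div, Real.log_inv]
  -- the determinant
  have hdet : ∀ z : ℤ → Fin l, (Lmat p q z).det = (∏ j, q j (z 0)) * p.det := by
    intro z
    rw [← Matrix.det_mul_row]
    rfl
  have hlogdet : ∀ z : ℤ → Fin l,
      Real.log |p.det| + k * Real.log (sInf S) ≤ Real.log |(Lmat p q z).det| := by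
    intro z
    have hprod : 0 < ∏ j, q j (z 0) := Finset.prod_pos fun j _ => hH1q j _
    rw [hdet, abs_mul, abs_of_pos hprod,
      Real.log_mul hprod.ne' (abs_pos.mpr hH2p).ne',
      Real.log_prod (fun j _ => (hH1q j _).ne')]
    have : ∑ j : Fin k, Real.log (sInf S) ≤ ∑ j, Real.log (q j (z 0)) :=
      Finset.sum_le_sum fun j _ => Real.log_le_log hmpos (hmle j _)
    simp at this
    linarith
  have hint : Integrable (fun z : ℤ → Fin l => Real.log |(Lmat p q z).det|) μ := by
    simp only [hdet]
    have hm : Measurable (fun z : ℤ → Fin l => z 0) := measurable_pi_apply 0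
    haveI : IsProbabilityMeasure (μ.map (fun z : ℤ → Fin l => z 0)) :=
      Measure.isProbabilityMeasure_map hm.aemeasurable
    have h : Integrable (fun m : Fin l => Real.log |(∏ j, q j m) * p.det|)
        (μ.map (fun z : ℤ → Fin l => z 0)) := Integrable.of_finite
    exact h.comp_measurable hm
  have hsum_ge : Real.log |p.det| + k * Real.log (sInf S) ≤ ∑ i, lam i := by
    rw [hlam_sum]
    have := integral_mono (μ := μ) (integrable_const _) hint hlogdet
    simpa using this
  -- the top exponent is nonpositive
  have hbd : ∀ (n : ℕ) (z : ℤ → Fin l) (i : Fin k),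
      0 ≤ (Lpow p q n z).mulVec (fun _ => (1 : ℝ)) i ∧
        (Lpow p q n z).mulVec (fun _ => (1 : ℝ)) i ≤ 1 := by
    intro n z
    induction n with
    | zero => intro i; simp [Lpow]
    | succ n ih =>
      intro i
      have hq1 : ∀ j m, q j m ≤ 1 := by
        intro j m
        rw [← hq_row j]
        exact Finset.single_le_sum (f := fun m => q j m)
          (fun m _ => (hH1q j m).le) (Finset.mem_univ m)
      rw [Lpow, ← Matrix.mulVec_mulVec]
      generalize (Lpow p q n z).mulVec (fun _ => (1 : ℝ)) = v at ih
      simp only [Matrix.mulVec, dotProduct, Lmat, Matrix.of_apply]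
      constructor
      · exact Finset.sum_nonneg fun j _ =>
          mul_nonneg (mul_nonneg (hH1q _ _).le (hH1p _ _).le) (ih j).1
      · rw [← hp_row i]
        refine Finset.sum_le_sum fun j _ => ?_
        have h1 : q j (invShift^[n] z 0) * p i j ≤ p i j :=
          mul_le_of_le_one_left (hH1p i j).le (hq1 _ _)
        have h0 : 0 ≤ q j (invShift^[n] z 0) * p i j :=
          mul_nonneg (hH1q _ _).le (hH1p _ _).le
        exact (mul_le_of_le_one_right h0 (ih j).2).trans h1
  have hlam0 : lam ⟨0, by omega⟩ ≤ 0 := by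
    obtain ⟨z, hz⟩ := hlam_top.exists
    have hlim : Tendsto (fun n : ℕ => Real.log (Real.sqrt k) / (n : ℝ)) atTop (nhds 0) :=
      tendsto_const_div_atTop_nhds_zero_nat _
    refine le_of_tendsto_of_tendsto' hz hlim fun n => ?_
    refine div_le_div_of_nonneg_right ?_ (Nat.cast_nonneg n)
    have hle : enorm2 ((Lpow p q n z).mulVec fun _ => (1 : ℝ)) ≤ Real.sqrt k := by
      refine Real.sqrt_le_sqrt ?_
      have : ∑ i, (Lpow p q n z).mulVec (fun _ => (1 : ℝ)) i ^ 2 ≤ ∑ i : Fin k, (1 : ℝ) :=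
        Finset.sum_le_sum fun i _ => pow_le_one₀ (hbd n z i).1 (hbd n z i).2
      simpa using this
    have hnn : 0 ≤ enorm2 ((Lpow p q n z).mulVec fun _ => (1 : ℝ)) := Real.sqrt_nonneg _
    rcases hnn.eq_or_lt with h | h
    · rw [← h, Real.log_zero]
      apply Real.log_nonneg
      rw [Real.one_le_sqrt]
      linarith
    · exact Real.log_le_log h hle
  -- comparison of the sum with the second exponent
  have hsum_le : ∑ i, lam i ≤ lam ⟨0, by omega⟩ + ((k : ℝ) - 1) * lam ⟨1, by omega⟩ := by
    have h0 : (⟨0, by omega⟩ : Fin k) ∈ (Finset.univ : Finset (Fin k)) := Finset.mem_univ _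
    rw [← Finset.add_sum_erase _ _ h0]
    have h1 := Finset.sum_le_card_nsmul (Finset.univ.erase (⟨0, by omega⟩ : Fin k)) lam
      (lam ⟨1, by omega⟩) (fun i hi => by
        apply hlam_mono
        have hne := Finset.ne_of_mem_erase hi
        rw [Fin.le_def]
        have : (i : ℕ) ≠ 0 := fun h => hne (Fin.ext h)
        show 1 ≤ (i : ℕ)
        omega)
    rw [Finset.card_erase_of_mem h0, Finset.card_univ, Fintype.card_fin, nsmul_eq_mul,
      Nat.cast_sub (by omega), Nat.cast_one] at h1
    linarith
  have hk0 : (0 : ℝ) ≤ k := Nat.cast_nonneg k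
  have hkl0 : (k : ℝ) * lam ⟨0, by omega⟩ ≤ 0 := mul_nonpos_of_nonneg_of_nonpos hk0 hlam0
  have hrw : (1 / (k - 1 : ℝ)) * Real.log |p.det| - ((k : ℝ) / (k - 1 : ℝ)) * Real.log R
      = (Real.log |p.det| + k * Real.log (sInf S)) / ((k : ℝ) - 1) := by
    rw [hlogR]
    field_simp
    ring
  rw [ge_iff_le, hrw, div_le_iff₀ hk1]
  nlinarith

end
end

section
/- Assume (H1) and the Oseledec hypothesis. Then for μ-almost every z ∈ B^ℤ, every nonzero vector ξ ∈ V(z) has two nonzero components of opposite signs: there exist indices i, j ∈ {1,…,k} with ξ_i > 0 and ξ_j < 0. -/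
open Filter MeasureTheory Matrix

noncomputable section

lemma Lmat_pos {k l : ℕ} (p : Matrix (Fin k) (Fin k) ℝ) (q : Matrix (Fin k) (Fin l) ℝ)
    (hp : ∀ i j, 0 < p i j) (hq : ∀ i m, 0 < q i m) (z : ℤ → Fin l) (i j : Fin k) :
    0 < Lmat p q z i j := by
  simpa [Lmat] using mul_pos (hq j (z 0)) (hp i j)

lemma mulVec_pos_aux {k : ℕ} (M : Matrix (Fin k) (Fin k) ℝ) (hM : ∀ i j, 0 < M i j)
    (a : Fin k → ℝ) (ha : ∀ i, 0 ≤ a i) (ha0 : a ≠ 0) (i : Fin k) : 0 < M.mulVec a i := by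
  obtain ⟨j, hj⟩ := Function.ne_iff.mp ha0
  have hj' : 0 < a j := lt_of_le_of_ne (ha j) (Ne.symm hj)
  simp only [Matrix.mulVec, dotProduct]
  exact Finset.sum_pos' (fun x _ => mul_nonneg (hM i x).le (ha x))
    ⟨j, Finset.mem_univ _, mul_pos (hM i j) hj'⟩

lemma Lpow_pos {k l : ℕ} (p : Matrix (Fin k) (Fin k) ℝ) (q : Matrix (Fin k) (Fin l) ℝ)
    (hp : ∀ i j, 0 < p i j) (hq : ∀ i m, 0 < q i m) (z : ℤ → Fin l)
    (a : Fin k → ℝ) (ha : ∀ i, 0 ≤ a i) (ha0 : a ≠ 0) (n : ℕ) :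
    ∀ i, 0 < (Lpow p q (n + 1) z).mulVec a i := by
  induction n with
  | zero =>
    intro i
    simpa [Lpow] using mulVec_pos_aux _ (Lmat_pos p q hp hq z) a ha ha0 i
  | succ n ih =>
    intro i
    rw [Lpow, ← Matrix.mulVec_mulVec]
    exact mulVec_pos_aux _ (Lmat_pos p q hp hq _) _ (fun j => (ih j).le)
      (fun h => (ih i).ne' (congrFun h i)) i

lemma Lpow_compare {k l : ℕ} (p : Matrix (Fin k) (Fin k) ℝ) (q : Matrix (Fin k) (Fin l) ℝ)
    (hp : ∀ i j, 0 < p i j) (hq : ∀ i m, 0 < q i m) (z : ℤ → Fin l)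
    (a b : Fin k → ℝ) (ha : ∀ i, 0 ≤ a i) (ha0 : a ≠ 0) (hb : ∀ i, 0 ≤ b i) (hb0 : b ≠ 0) :
    ∃ C : ℝ, 0 < C ∧ ∀ (n : ℕ) (i : Fin k),
      (Lpow p q (n + 1) z).mulVec a i ≤ C * (Lpow p q (n + 1) z).mulVec b i := by
  have pa := Lpow_pos p q hp hq z a ha ha0 0
  have pb := Lpow_pos p q hp hq z b hb hb0 0
  obtain ⟨i0, -⟩ := Function.ne_iff.mp ha0
  set A := (Lpow p q (0 + 1) z).mulVec a with hA
  set B := (Lpow p q (0 + 1) z).mulVec b with hB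
  refine ⟨∑ i, A i / B i, Finset.sum_pos (fun i _ => div_pos (pa i) (pb i))
    ⟨i0, Finset.mem_univ _⟩, ?_⟩
  intro n
  induction n with
  | zero =>
    intro i
    rw [← hA, ← hB, ← div_le_iff₀ (pb i)]
    exact Finset.single_le_sum (f := fun i => A i / B i)
      (fun i _ => (div_pos (pa i) (pb i)).le) (Finset.mem_univ i)
  | succ n ih =>
    intro i
    rw [Lpow, ← Matrix.mulVec_mulVec, ← Matrix.mulVec_mulVec]
    simp only [Matrix.mulVec, dotProduct] at ih ⊢
    rw [Finset.mul_sum]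
    refine Finset.sum_le_sum fun j _ => ?_
    rw [mul_left_comm]
    exact mul_le_mul_of_nonneg_left (ih j) (Lmat_pos p q hp hq _ i j).le

lemma enorm2_pos {k : ℕ} (hk : 0 < k) (a : Fin k → ℝ) (ha : ∀ i, 0 < a i) : 0 < enorm2 a := by
  refine Real.sqrt_pos.mpr (Finset.sum_pos (fun i _ => pow_pos (ha i) 2)
    ⟨⟨0, hk⟩, Finset.mem_univ _⟩)

lemma enorm2_le {k : ℕ} (a b : Fin k → ℝ) (ha : ∀ i, 0 ≤ a i) (C : ℝ) (hC : 0 < C)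
    (h : ∀ i, a i ≤ C * b i) : enorm2 a ≤ C * enorm2 b := by
  unfold enorm2
  rw [← Real.sqrt_sq hC.le, ← Real.sqrt_mul (sq_nonneg C)]
  refine Real.sqrt_le_sqrt ?_
  rw [Finset.mul_sum]
  refine Finset.sum_le_sum fun i _ => ?_
  rw [← mul_pow]
  exact pow_le_pow_left₀ (ha i) (h i) 2

lemma log_compare {k l : ℕ} (hk : 0 < k)
    (p : Matrix (Fin k) (Fin k) ℝ) (q : Matrix (Fin k) (Fin l) ℝ)
    (hp : ∀ i j, 0 < p i j) (hq : ∀ i m, 0 < q i m) (z : ℤ → Fin l)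
    (a b : Fin k → ℝ) (ha : ∀ i, 0 ≤ a i) (ha0 : a ≠ 0) (hb : ∀ i, 0 ≤ b i) (hb0 : b ≠ 0) :
    ∃ c : ℝ, ∀ n : ℕ, 1 ≤ n → Real.log (enorm2 ((Lpow p q n z).mulVec a)) / n ≤
      c / n + Real.log (enorm2 ((Lpow p q n z).mulVec b)) / n := by
  obtain ⟨C, hC, h⟩ := Lpow_compare p q hp hq z a b ha ha0 hb hb0
  refine ⟨Real.log C, fun n hn => ?_⟩
  obtain ⟨m, rfl⟩ : ∃ m, n = m + 1 := ⟨n - 1, by omega⟩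
  have pa := Lpow_pos p q hp hq z a ha ha0 m
  have pb := Lpow_pos p q hp hq z b hb hb0 m
  rw [← add_div, ← Real.log_mul hC.ne' (enorm2_pos hk _ pb).ne']
  exact div_le_div_of_nonneg_right (Real.log_le_log (enorm2_pos hk _ pa)
    (enorm2_le _ _ (fun i => (pa i).le) C hC (h m))) (Nat.cast_nonneg _)

lemma nonneg_not_slow {k l : ℕ} (hk : 0 < k)
    (p : Matrix (Fin k) (Fin k) ℝ) (q : Matrix (Fin k) (Fin l) ℝ)
    (hp : ∀ i j, 0 < p i j) (hq : ∀ i m, 0 < q i m) (z : ℤ → Fin l)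
    (lam1 lam2 : ℝ) (hlam : lam2 < lam1) (W : Submodule ℝ (Fin k → ℝ)) (hW : W ≠ ⊤)
    (h1 : ∀ w : Fin k → ℝ, w ∉ W →
        Tendsto (fun n : ℕ => Real.log (enorm2 ((Lpow p q n z).mulVec w)) / n)
          atTop (nhds lam1))
    (h2 : ∀ ξ : Fin k → ℝ, ξ ∈ W → ξ ≠ 0 →
        Filter.limsup (fun n : ℕ => Real.log (enorm2 ((Lpow p q n z).mulVec ξ)) / n)
          atTop ≤ lam2)
    (ξ : Fin k → ℝ) (hξ : ξ ∈ W) (hξ0 : ξ ≠ 0) (hpos : ∀ i, 0 ≤ ξ i) : False := by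
  obtain ⟨i, hi⟩ : ∃ i : Fin k, (Pi.single i 1 : Fin k → ℝ) ∉ W := by
    by_contra! hall
    refine hW (eq_top_iff.mpr fun v _ => ?_)
    rw [pi_eq_sum_univ' v]
    exact W.sum_mem fun i _ => W.smul_mem _ (by simpa [Pi.single_apply, Pi.single, Function.update, funext_iff] using hall i)
  set w : Fin k → ℝ := Pi.single i 1 with hw
  have hw0 : w ≠ 0 := fun h => hi (h ▸ W.zero_mem)
  have hwp : ∀ j, 0 ≤ w j := fun j => by
    have : (0 : Fin k → ℝ) ≤ Pi.single i 1 := Pi.single_nonneg.mpr zero_le_one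
    exact this j
  obtain ⟨c, hc⟩ := log_compare hk p q hp hq z w ξ hwp hw0 hpos hξ0
  obtain ⟨d, hd⟩ := log_compare hk p q hp hq z ξ w hpos hξ0 hwp hw0
  have ht := h1 w hi
  have hlim : Tendsto (fun n : ℕ => Real.log (enorm2 ((Lpow p q n z).mulVec ξ)) / n)
      atTop (nhds lam1) := by
    have hlo := ht.sub (tendsto_const_div_atTop_nhds_zero_nat c)
    have hup := (tendsto_const_div_atTop_nhds_zero_nat d).add ht
    rw [sub_zero] at hlo
    rw [zero_add] at hup
    refine tendsto_of_tendsto_of_tendsto_of_le_of_le' hlo hup ?_ ?_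
    · filter_upwards [eventually_ge_atTop 1] with n hn
      linarith [hc n hn]
    · filter_upwards [eventually_ge_atTop 1] with n hn
      exact hd n hn
  have := h2 ξ hξ hξ0
  rw [hlim.limsup_eq] at this
  linarith

/-- **Lemma (signs).** Under (H1) and the Oseledec hypothesis, for `μ`-almost every `z`,
every nonzero `ξ ∈ V(z)` has two nonzero components of opposite signs. -/
theorem slow_space_opposite_signs
    (k l : ℕ) (hk : 0 < k) (hkl : k ≤ l)
    (p : Matrix (Fin k) (Fin k) ℝ) (q : Matrix (Fin k) (Fin l) ℝ)
    (hp_row : ∀ i, ∑ j, p i j = 1)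
    (hq_row : ∀ i, ∑ m, q i m = 1)
    -- Hypothesis (H1)
    (hH1p : ∀ i j, 0 < p i j)
    (hH1q : ∀ i m, 0 < q i m)
    -- a shift-invariant ergodic probability measure
    (μ : Measure (ℤ → Fin l)) [IsProbabilityMeasure μ]
    (herg : Ergodic shift μ)
    -- Oseledec hypothesis
    (lam1 lam2 : ℝ) (hlam : lam2 < lam1)
    (V : (ℤ → Fin l) → Submodule ℝ (Fin k → ℝ))
    (hosel : ∀ᵐ z ∂μ,
      V z ≠ ⊤ ∧
      (∀ v ∈ V z, (Lmat p q z).mulVec v ∈ V (invShift z)) ∧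
      (∀ w : Fin k → ℝ, w ∉ V z →
        Tendsto (fun n : ℕ => Real.log (enorm2 ((Lpow p q n z).mulVec w)) / n)
          atTop (nhds lam1)) ∧
      (∀ ξ : Fin k → ℝ, ξ ∈ V z → ξ ≠ 0 →
        Filter.limsup (fun n : ℕ => Real.log (enorm2 ((Lpow p q n z).mulVec ξ)) / n)
          atTop ≤ lam2)) :
    ∀ᵐ z ∂μ, ∀ ξ ∈ V z, ξ ≠ 0 → ∃ i j : Fin k, 0 < ξ i ∧ ξ j < 0 := by
  filter_upwards [hosel] with z hz ξ hξ hξ0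
  obtain ⟨hV, -, h1, h2⟩ := hz
  have key := nonneg_not_slow hk p q hH1p hH1q z lam1 lam2 hlam (V z) hV h1 h2
  by_contra hcon
  by_cases hpos : ∀ i, 0 ≤ ξ i
  · exact key ξ hξ hξ0 hpos
  · obtain ⟨j, hj⟩ := not_forall.mp hpos
    refine key (-ξ) ((V z).neg_mem hξ) (neg_ne_zero.mpr hξ0) fun i => ?_
    by_contra hi
    simp only [Pi.neg_apply] at hi
    exact hcon ⟨i, j, by linarith, not_le.mp hj⟩

end
end

section
/- Assume (H1) and the Oseledec hypothesis. Then for μ-almost every z ∈ B^ℤ, the subspace V(z) has codimension exactly 1 in ℝ^k, i.e. dim V(z) = k − 1. -/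
open Filter MeasureTheory Matrix

noncomputable section

/-- One-step contraction of the ratio interval under a matrix with entries in `[a,1]`. -/
theorem aux_step {k : ℕ} (hk : 0 < k) (a : ℝ) (ha : 0 < a) (ha1 : a < 1)
    (A : Matrix (Fin k) (Fin k) ℝ) (hA : ∀ i j, a ≤ A i j) (hA1 : ∀ i j, A i j ≤ 1)
    (W X : Fin k → ℝ) (hW : ∀ i, 0 < W i) (m M : ℝ)
    (hm : ∀ i, m * W i ≤ X i) (hM : ∀ i, X i ≤ M * W i) :
    ∃ m' M' : ℝ, m ≤ m' ∧ M' ≤ M ∧ M' - m' = (1 - a) * (M - m) ∧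
      (∀ i, m' * (A.mulVec W) i ≤ (A.mulVec X) i) ∧
      (∀ i, (A.mulVec X) i ≤ M' * (A.mulVec W) i) := by
  have : Nonempty (Fin k) := ⟨⟨0, hk⟩⟩
  have hS : 0 < ∑ j, W j := Finset.sum_pos (fun j _ => hW j) Finset.univ_nonempty
  set S := ∑ j, (X j - m * W j) with hSdef
  set T := ∑ j, (M * W j - X j) with hTdef
  have hS0 : 0 ≤ S := Finset.sum_nonneg fun j _ => sub_nonneg.2 (hm j)
  have hT0 : 0 ≤ T := Finset.sum_nonneg fun j _ => sub_nonneg.2 (hM j)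
  have hST : S + T = (M - m) * ∑ j, W j := by
    rw [hSdef, hTdef, ← Finset.sum_add_distrib, Finset.mul_sum]
    exact Finset.sum_congr rfl fun j _ => by ring
  have hAW : ∀ i, (A.mulVec W) i ≤ ∑ j, W j := fun i => by
    simp only [Matrix.mulVec, dotProduct]
    exact Finset.sum_le_sum fun j _ => by nlinarith [hA1 i j, hW j]
  have h1 : ∀ i, a * S ≤ (A.mulVec X) i - m * (A.mulVec W) i := fun i => by
    simp only [Matrix.mulVec, dotProduct]
    rw [hSdef, Finset.mul_sum, Finset.mul_sum, ← Finset.sum_sub_distrib]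
    exact Finset.sum_le_sum fun j _ => by
      nlinarith [mul_nonneg (sub_nonneg.2 (hA i j)) (sub_nonneg.2 (hm j))]
  have h2 : ∀ i, a * T ≤ M * (A.mulVec W) i - (A.mulVec X) i := fun i => by
    simp only [Matrix.mulVec, dotProduct]
    rw [hTdef, Finset.mul_sum, Finset.mul_sum, ← Finset.sum_sub_distrib]
    exact Finset.sum_le_sum fun j _ => by
      nlinarith [mul_nonneg (sub_nonneg.2 (hA i j)) (sub_nonneg.2 (hM j))]
  have key : ∀ R : ℝ, 0 ≤ R → ∀ i, a * (R / ∑ j, W j) * (A.mulVec W) i ≤ a * R := by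
    intro R hR i
    have : a * (R / ∑ j, W j) * (A.mulVec W) i ≤ a * (R / ∑ j, W j) * ∑ j, W j :=
      mul_le_mul_of_nonneg_left (hAW i) (by positivity)
    calc _ ≤ _ := this
      _ = a * R := by field_simp
  refine ⟨m + a * (S / ∑ j, W j), M - a * (T / ∑ j, W j), ?_, ?_, ?_, ?_, ?_⟩
  · have : 0 ≤ a * (S / ∑ j, W j) := by positivity
    linarith
  · have : 0 ≤ a * (T / ∑ j, W j) := by positivity
    linarith
  · have : S / (∑ j, W j) + T / (∑ j, W j) = M - m := by
      rw [← add_div, hST]; field_simp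
    linear_combination (-a) * this
  · intro i; linarith [key S hS0 i, h1 i]
  · intro i; linarith [key T hT0 i, h2 i]

/-- Exponential contraction along a product of matrices. -/
theorem aux_contract {k : ℕ} (hk : 0 < k) (a : ℝ) (ha : 0 < a) (ha1 : a < 1)
    (A : ℕ → Matrix (Fin k) (Fin k) ℝ) (hA : ∀ n i j, a ≤ A n i j) (hA1 : ∀ n i j, A n i j ≤ 1)
    (W X : ℕ → Fin k → ℝ) (hW : ∀ n i, 0 < W n i)
    (hWs : ∀ n, W (n + 1) = (A n).mulVec (W n)) (hXs : ∀ n, X (n + 1) = (A n).mulVec (X n)) :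
    ∃ t C : ℝ, 0 < C ∧ ∀ n i, |X n i - t * W n i| ≤ C * (1 - a) ^ n * W n i := by
  have : Nonempty (Fin k) := ⟨⟨0, hk⟩⟩
  choose! fm fM h1 h2 h3 h4 h5 using
    fun (n : ℕ) (m M : ℝ) (hm : ∀ i, m * W n i ≤ X n i) (hM : ∀ i, X n i ≤ M * W n i) =>
      aux_step hk a ha ha1 (A n) (hA n) (hA1 n) (W n) (X n) (hW n) m M hm hM
  obtain ⟨i0, hi0⟩ := Finite.exists_min fun i => X 0 i / W 0 i
  obtain ⟨i1, hi1⟩ := Finite.exists_max fun i => X 0 i / W 0 i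
  let F : ℕ → ℝ × ℝ := fun n => Nat.rec (X 0 i0 / W 0 i0, X 0 i1 / W 0 i1)
    (fun n r => (fm n r.1 r.2, fM n r.1 r.2)) n
  have hF : ∀ n, F (n + 1) = (fm n (F n).1 (F n).2, fM n (F n).1 (F n).2) := fun n => rfl
  have inv : ∀ n, (∀ i, (F n).1 * W n i ≤ X n i) ∧ (∀ i, X n i ≤ (F n).2 * W n i) := by
    intro n
    induction n with
    | zero =>
      exact ⟨fun i => (le_div_iff₀ (hW 0 i)).1 (hi0 i), fun i => (div_le_iff₀ (hW 0 i)).1 (hi1 i)⟩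
    | succ n ih =>
      rw [hF, hWs, hXs]
      exact ⟨h4 n _ _ ih.1 ih.2, h5 n _ _ ih.1 ih.2⟩
  have hmono : Monotone fun n => (F n).1 :=
    monotone_nat_of_le_succ fun n => by
      rw [hF]; exact h1 n _ _ (inv n).1 (inv n).2
  have hanti : Antitone fun n => (F n).2 :=
    antitone_nat_of_succ_le fun n => by
      rw [hF]; exact h2 n _ _ (inv n).1 (inv n).2
  have hgap : ∀ n, (F n).2 - (F n).1 = (1 - a) ^ n * ((F 0).2 - (F 0).1) := by
    intro n
    induction n with
    | zero => simp
    | succ n ih =>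
      rw [hF]
      have := h3 n _ _ (inv n).1 (inv n).2
      simp only [this, ih]; ring
  have hle : ∀ n, (F n).1 ≤ (F n).2 := fun n => by
    have := ((inv n).1 i0).trans ((inv n).2 i0)
    exact le_of_mul_le_mul_right this (hW n i0)
  have hmem := hmono.ciSup_mem_iInter_Icc_of_antitone hanti hle
  rw [Set.mem_iInter] at hmem
  refine ⟨⨆ n, (F n).1, (F 0).2 - (F 0).1 + 1, by linarith [hle 0], fun n i => ?_⟩
  obtain ⟨hl, hr⟩ := hmem n
  set t := ⨆ n, (F n).1
  have hg := hgap n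
  have hp : 0 < (1 - a) ^ n := pow_pos (by linarith) n
  have hw := hW n i
  have h6 : ((F n).2 - (F n).1) * W n i ≤ ((F 0).2 - (F 0).1 + 1) * (1 - a) ^ n * W n i :=
    mul_le_mul_of_nonneg_right (by rw [hg]; nlinarith) hw.le
  have h7 := (inv n).1 i
  have h8 := (inv n).2 i
  have h9 := mul_le_mul_of_nonneg_right hl hw.le
  have h10 := mul_le_mul_of_nonneg_right hr hw.le
  rw [abs_le]
  constructor <;> linarith

theorem aux_enorm2_le {k : ℕ} (u v : Fin k → ℝ) (c : ℝ) (hc : 0 ≤ c)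
    (h : ∀ i, |u i| ≤ c * v i) : enorm2 u ≤ c * enorm2 v := by
  unfold enorm2
  rw [← Real.sqrt_sq hc, ← Real.sqrt_mul (sq_nonneg _)]
  apply Real.sqrt_le_sqrt
  rw [Finset.mul_sum]
  refine Finset.sum_le_sum fun i _ => ?_
  rw [← mul_pow, ← sq_abs (u i)]
  exact pow_le_pow_left₀ (abs_nonneg _) (h i) 2

theorem aux_enorm2_pos {k : ℕ} (hk : 0 < k) (v : Fin k → ℝ) (h : ∀ i, 0 < v i) :
    0 < enorm2 v := by
  have : Nonempty (Fin k) := ⟨⟨0, hk⟩⟩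
  exact Real.sqrt_pos.2 (Finset.sum_pos (fun i _ => pow_pos (h i) 2) Finset.univ_nonempty)

/-- If `y n ≤ C ρ^n w n` with positive terms, the exponential rates differ by `log ρ`. -/
theorem aux_rate (y w : ℕ → ℝ) (C ρ α β : ℝ) (hC : 0 < C) (hρ : 0 < ρ)
    (hw : ∀ n, 0 < w n) (hy : ∀ᶠ n in atTop, 0 < y n) (hyw : ∀ n, y n ≤ C * ρ ^ n * w n)
    (h1 : Tendsto (fun n : ℕ => Real.log (y n) / n) atTop (nhds α))
    (h2 : Tendsto (fun n : ℕ => Real.log (w n) / n) atTop (nhds β)) :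
    α ≤ Real.log ρ + β := by
  have h3 : Tendsto (fun n : ℕ => Real.log C / n + Real.log ρ + Real.log (w n) / n) atTop
      (nhds (0 + Real.log ρ + β)) :=
    ((tendsto_const_div_atTop_nhds_zero_nat _).add tendsto_const_nhds).add h2
  rw [zero_add] at h3
  refine le_of_tendsto_of_tendsto h1 h3 ?_
  filter_upwards [hy, eventually_gt_atTop 0] with n hn hn0
  have hn' : (0 : ℝ) < n := by exact_mod_cast hn0
  have h4 := Real.log_le_log hn (hyw n)
  rw [Real.log_mul (by positivity) (hw n).ne', Real.log_mul hC.ne' (by positivity),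
    Real.log_pow] at h4
  rw [div_le_iff₀ hn']
  calc _ ≤ _ := h4
    _ = _ := by field_simp

/-- **Lemma (codimension).** Under (H1) and the Oseledec hypothesis, for `μ`-almost
every `z`, the slow subspace `V(z)` has codimension exactly `1`: `dim V(z) = k - 1`. -/
theorem slow_space_codim_one
    (k l : ℕ) (hk : 0 < k) (hkl : k ≤ l)
    (p : Matrix (Fin k) (Fin k) ℝ) (q : Matrix (Fin k) (Fin l) ℝ)
    (hp_row : ∀ i, ∑ j, p i j = 1)
    (hq_row : ∀ i, ∑ m, q i m = 1)
    -- Hypothesis (H1)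
    (hH1p : ∀ i j, 0 < p i j)
    (hH1q : ∀ i m, 0 < q i m)
    -- a shift-invariant ergodic probability measure
    (μ : Measure (ℤ → Fin l)) [IsProbabilityMeasure μ]
    (herg : Ergodic shift μ)
    -- Oseledec hypothesis
    (lam1 lam2 : ℝ) (hlam : lam2 < lam1)
    (V : (ℤ → Fin l) → Submodule ℝ (Fin k → ℝ))
    (hosel : ∀ᵐ z ∂μ,
      V z ≠ ⊤ ∧
      (∀ v ∈ V z, (Lmat p q z).mulVec v ∈ V (invShift z)) ∧
      (∀ w : Fin k → ℝ, w ∉ V z →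
        Tendsto (fun n : ℕ => Real.log (enorm2 ((Lpow p q n z).mulVec w)) / n)
          atTop (nhds lam1)) ∧
      (∀ ξ : Fin k → ℝ, ξ ∈ V z → ξ ≠ 0 →
        Filter.limsup (fun n : ℕ => Real.log (enorm2 ((Lpow p q n z).mulVec ξ)) / n)
          atTop ≤ lam2)) :
    ∀ᵐ z ∂μ, Module.finrank ℝ (V z) = k - 1 := by
  rcases Nat.lt_or_ge 1 k with hk2 | hk1
  swap
  · filter_upwards [hosel] with z hz
    have h := Submodule.finrank_lt hz.1
    simp only [Module.finrank_fin_fun] at h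
    omega
  have : Nonempty (Fin k) := ⟨⟨0, hk⟩⟩
  have : Nonempty (Fin l) := ⟨⟨0, by omega⟩⟩
  have : Nontrivial (Fin l) := Fin.nontrivial_iff_two_le.2 (by omega)
  have hq1 : ∀ i m, q i m < 1 := by
    intro i m
    obtain ⟨m', hm'⟩ := exists_ne m
    rw [← hq_row i]
    exact Finset.single_lt_sum hm' (Finset.mem_univ _) (Finset.mem_univ _) (hH1q i m')
      (fun j _ _ => (hH1q i j).le)
  have hp1 : ∀ i j, p i j ≤ 1 := by
    intro i j
    rw [← hp_row i]
    exact Finset.single_le_sum (f := fun j => p i j) (fun j _ => (hH1p i j).le) (Finset.mem_univ j)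
  obtain ⟨x0, hx0⟩ := Finite.exists_min
    fun x : Fin k × Fin k × Fin l => q x.2.1 x.2.2 * p x.1 x.2.1
  obtain ⟨x1, hx1⟩ := Finite.exists_max fun x : Fin k × Fin l => q x.1 x.2
  set a := q x0.2.1 x0.2.2 * p x0.1 x0.2.1 with hadef
  set Q := q x1.1 x1.2 with hQdef
  have ha : 0 < a := mul_pos (hH1q _ _) (hH1p _ _)
  have ha1 : a < 1 := by
    have := hq1 x0.2.1 x0.2.2
    have := hp1 x0.1 x0.2.1
    have := hH1q x0.2.1 x0.2.2
    nlinarith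
  have hQ0 : 0 < Q := hH1q _ _
  have hQ1 : Q < 1 := hq1 _ _
  filter_upwards [hosel] with z hz
  obtain ⟨hVtop, -, hfast, -⟩ := hz
  -- matrix entries
  have hA : ∀ n i j, a ≤ Lmat p q (invShift^[n] z) i j := fun n i j =>
    hx0 (i, j, (invShift^[n] z) 0)
  have hA1 : ∀ n i j, Lmat p q (invShift^[n] z) i j ≤ 1 := fun n i j => by
    show q j _ * p i j ≤ 1
    exact mul_le_one₀ (hq1 _ _).le (hH1p _ _).le (hp1 _ _)
  have hstep : ∀ (v : Fin k → ℝ) n, (Lpow p q (n + 1) z).mulVec v =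
      (Lmat p q (invShift^[n] z)).mulVec ((Lpow p q n z).mulVec v) := fun v n => by
    rw [Matrix.mulVec_mulVec]; rfl
  -- a positive vector outside V z
  obtain ⟨w, hwpos, hwV⟩ : ∃ w : Fin k → ℝ, (∀ i, 0 < w i) ∧ w ∉ V z := by
    by_cases h1 : (fun _ => (1 : ℝ)) ∈ V z
    · obtain ⟨y, hy⟩ : ∃ y, y ∉ V z := by
        by_contra! h
        exact hVtop (Submodule.eq_top_iff'.2 h)
      refine ⟨y + (∑ i, |y i| + 1) • (fun _ => (1 : ℝ)), fun i => ?_, fun h => hy ?_⟩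
      · have h2 : |y i| ≤ ∑ i, |y i| :=
          Finset.single_le_sum (f := fun i => |y i|) (fun j _ => abs_nonneg _) (Finset.mem_univ i)
        have h3 := neg_abs_le (y i)
        simp only [Pi.add_apply, Pi.smul_apply, smul_eq_mul, mul_one]
        linarith
      · exact (Submodule.add_mem_iff_left _ ((V z).smul_mem _ h1)).1 h
    · exact ⟨_, fun _ => one_pos, h1⟩
  have hWpos : ∀ n i, 0 < (Lpow p q n z).mulVec w i := by
    intro n
    induction n with
    | zero => intro i; simpa [Lpow] using hwpos i
    | succ n ih =>
      intro i
      rw [hstep]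
      simp only [Matrix.mulVec, dotProduct] at ih ⊢
      exact Finset.sum_pos (fun j _ => mul_pos (ha.trans_le (hA n i j)) (ih j))
        Finset.univ_nonempty
  have hWn : ∀ n, 0 < enorm2 ((Lpow p q n z).mulVec w) := fun n =>
    aux_enorm2_pos hk _ (hWpos n)
  have hWlim := hfast w hwV
  -- lam1 is negative
  have hlam1 : lam1 < 0 := by
    obtain ⟨i1, hi1⟩ := Finite.exists_max w
    have hb : ∀ n i, (Lpow p q n z).mulVec w i ≤ w i1 * Q ^ n := by
      intro n
      induction n with
      | zero => intro i; simpa [Lpow] using hi1 i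
      | succ n ih =>
        intro i
        rw [hstep]
        have h5 : ∀ j, Lmat p q (invShift^[n] z) i j * (Lpow p q n z).mulVec w j ≤
            p i j * (w i1 * Q ^ (n + 1)) := fun j => by
          have h6 : Lmat p q (invShift^[n] z) i j ≤ Q * p i j :=
            mul_le_mul_of_nonneg_right (hx1 (j, (invShift^[n] z) 0)) (hH1p i j).le
          calc _ ≤ (Q * p i j) * (w i1 * Q ^ n) :=
                mul_le_mul h6 (ih j) (hWpos n j).le (mul_pos hQ0 (hH1p i j)).le
            _ = _ := by ring
        calc _ ≤ ∑ j, p i j * (w i1 * Q ^ (n + 1)) := Finset.sum_le_sum fun j _ => h5 j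
          _ = _ := by rw [← Finset.sum_mul, hp_row, one_mul]
    have hone : 0 < enorm2 (fun _ : Fin k => (1 : ℝ)) := aux_enorm2_pos hk _ fun _ => one_pos
    have h7 := aux_rate (fun n => enorm2 ((Lpow p q n z).mulVec w))
      (fun _ => enorm2 (fun _ : Fin k => (1 : ℝ))) (w i1) Q lam1 0 (hwpos i1) hQ0
      (fun _ => hone) (Eventually.of_forall hWn)
      (fun n => aux_enorm2_le _ _ _ (mul_nonneg (hwpos i1).le (pow_nonneg hQ0.le n))
        fun i => by rw [abs_of_pos (hWpos n i), mul_one]; exact hb n i)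
      hWlim (tendsto_const_div_atTop_nhds_zero_nat _)
    have := Real.log_neg hQ0 hQ1
    linarith
  -- every vector is in V z + span w
  have hdec : ∀ x : Fin k → ℝ, ∃ t : ℝ, x - t • w ∈ V z := by
    intro x
    obtain ⟨t, C, hC, ht⟩ := aux_contract hk a ha ha1 (fun n => Lmat p q (invShift^[n] z)) hA hA1
      (fun n => (Lpow p q n z).mulVec w) (fun n => (Lpow p q n z).mulVec x) hWpos
      (hstep w) (hstep x)
    refine ⟨t, ?_⟩
    by_contra hn
    have hlim := hfast _ hn
    have hpos : ∀ᶠ n in atTop, 0 < enorm2 ((Lpow p q n z).mulVec (x - t • w)) := by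
      filter_upwards [hlim.eventually_lt_const hlam1] with n h
      refine lt_of_le_of_ne (Real.sqrt_nonneg _) fun h0 => ?_
      rw [← h0] at h
      simp at h
    have h8 := aux_rate _ _ C (1 - a) lam1 lam1 hC (by linarith) hWn hpos
      (fun n => aux_enorm2_le _ _ _ (mul_nonneg hC.le (pow_nonneg (by linarith) n))
        fun i => by
          rw [Matrix.mulVec_sub, Matrix.mulVec_smul]
          exact ht n i) hlim hWlim
    have := Real.log_neg (show 0 < 1 - a by linarith) (by linarith)
    linarith
  have hsup : V z ⊔ Submodule.span ℝ {w} = ⊤ := by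
    rw [Submodule.eq_top_iff']
    intro x
    obtain ⟨t, ht⟩ := hdec x
    rw [Submodule.mem_sup]
    exact ⟨_, ht, t • w, Submodule.smul_mem _ _ (Submodule.mem_span_singleton_self w), by simp⟩
  have h9 := Submodule.finrank_add_le_finrank_add_finrank (V z) (Submodule.span ℝ {w})
  rw [hsup, finrank_top, Module.finrank_fin_fun] at h9
  have h10 : Module.finrank ℝ (Submodule.span ℝ {w}) ≤ 1 :=
    (finrank_span_le_card (R := ℝ) {w}).trans (by simp)
  have h11 := Submodule.finrank_lt hVtop
  rw [Module.finrank_fin_fun] at h11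
  omega


end
end

section
/- Assume (H1) and set α = (1/√k) min_{m∈B, i,j∈A} q(m|j) p(j|i) > 0. Then for every z ∈ B^ℤ, every n ≥ 1, every vector ξ ∈ ℝ^k with nonnegative components, and every nonzero w ∈ ℝ^k: ‖L_z^{[n]} ξ‖ ≥ α ‖ξ‖ ‖L^{[n−1]}_{S^{-1}z} 𝟙‖ and ‖L^{[n−1]}_{S^{-1}z} w‖ ≤ ‖w‖ ‖L^{[n−1]}_{S^{-1}z} 𝟙‖; in particular ‖L_z^{[n]} ξ‖ ≥ (α ‖ξ‖/‖w‖) ‖L^{[n−1]}_{S^{-1}z} w‖. -/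
open Filter MeasureTheory Matrix

noncomputable section

lemma aux_Lpow_succ {k l : ℕ} (p : Matrix (Fin k) (Fin k) ℝ) (q : Matrix (Fin k) (Fin l) ℝ)
    (n : ℕ) (z : ℤ → Fin l) :
    Lpow p q (n + 1) z = Lpow p q n (invShift z) * Lmat p q z := by
  induction n with
  | zero => simp [Lpow]
  | succ n ih =>
    rw [Lpow, ih, Lpow, Function.iterate_succ_apply, Matrix.mul_assoc]

lemma aux_Lpow_nonneg {k l : ℕ} (p : Matrix (Fin k) (Fin k) ℝ) (q : Matrix (Fin k) (Fin l) ℝ)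
    (hp : ∀ i j, 0 < p i j) (hq : ∀ i m, 0 < q i m) (n : ℕ) (z : ℤ → Fin l) :
    ∀ i j, 0 ≤ Lpow p q n z i j := by
  induction n with
  | zero =>
    intro i j
    rw [Lpow, Matrix.one_apply]
    split_ifs <;> norm_num
  | succ n ih =>
    intro i j
    rw [Lpow, Matrix.mul_apply]
    exact Finset.sum_nonneg fun m _ => mul_nonneg
      (mul_nonneg (hq _ _).le (hp _ _).le) (ih m j)

lemma aux_enorm2_mono {k : ℕ} (u v : Fin k → ℝ) (h : ∀ i, |u i| ≤ v i) :
    enorm2 u ≤ enorm2 v := by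
  refine Real.sqrt_le_sqrt (Finset.sum_le_sum fun i _ => ?_)
  exact sq_le_sq' (by linarith [neg_abs_le (u i), h i]) ((le_abs_self _).trans (h i))

lemma aux_enorm2_smul {k : ℕ} (c : ℝ) (hc : 0 ≤ c) (v : Fin k → ℝ) :
    enorm2 (fun i => c * v i) = c * enorm2 v := by
  unfold enorm2
  simp_rw [mul_pow]
  rw [← Finset.mul_sum, Real.sqrt_mul (sq_nonneg c), Real.sqrt_sq hc]

lemma aux_abs_le_enorm2 {k : ℕ} (v : Fin k → ℝ) (i : Fin k) : |v i| ≤ enorm2 v := by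
  refine Real.abs_le_sqrt ?_
  exact Finset.single_le_sum (f := fun i => v i ^ 2) (fun j _ => sq_nonneg _) (Finset.mem_univ i)

lemma aux_enorm2_le_sum {k : ℕ} (v : Fin k → ℝ) (h : ∀ i, 0 ≤ v i) : enorm2 v ≤ ∑ i, v i := by
  refine Real.sqrt_le_iff.2 ⟨Finset.sum_nonneg fun i _ => h i, ?_⟩
  rw [sq, Finset.sum_mul]
  refine Finset.sum_le_sum fun i _ => ?_
  rw [sq]
  exact mul_le_mul_of_nonneg_left
    (Finset.single_le_sum (fun j _ => h j) (Finset.mem_univ i)) (h i)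

lemma aux_mulVec_bound {k : ℕ} (M : Matrix (Fin k) (Fin k) ℝ) (hM : ∀ i j, 0 ≤ M i j)
    (w : Fin k → ℝ) :
    enorm2 (M.mulVec w) ≤ enorm2 w * enorm2 (M.mulVec fun _ => (1 : ℝ)) := by
  have h0 : 0 ≤ enorm2 w := Real.sqrt_nonneg _
  rw [← aux_enorm2_smul _ h0]
  refine aux_enorm2_mono _ _ fun i => ?_
  simp only [Matrix.mulVec, dotProduct]
  refine (Finset.abs_sum_le_sum_abs _ _).trans ?_
  rw [Finset.mul_sum]
  refine Finset.sum_le_sum fun j _ => ?_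
  rw [abs_mul, abs_of_nonneg (hM i j)]
  nlinarith [aux_abs_le_enorm2 w j, hM i j]

lemma aux_mulVec_lower {k : ℕ} (M : Matrix (Fin k) (Fin k) ℝ) (hM : ∀ i j, 0 ≤ M i j)
    (c : ℝ) (hc : 0 ≤ c) (u : Fin k → ℝ) (hu : ∀ i, c ≤ u i) :
    c * enorm2 (M.mulVec fun _ => (1 : ℝ)) ≤ enorm2 (M.mulVec u) := by
  rw [← aux_enorm2_smul _ hc]
  refine aux_enorm2_mono _ _ fun i => ?_
  simp only [Matrix.mulVec, dotProduct]
  rw [abs_of_nonneg (mul_nonneg hc (Finset.sum_nonneg fun j _ => by simpa using hM i j)),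
    Finset.mul_sum]
  refine Finset.sum_le_sum fun j _ => ?_
  nlinarith [hu j, hM i j]

/-- **Quantitative positivity estimates.** Under (H1), with
`α = (1/√k) min_{m,i,j} q(m|j) p(j|i) > 0`, for all `z`, `n ≥ 1`, nonnegative `ξ` and
nonzero `w`: `‖L_z^{[n]} ξ‖ ≥ α ‖ξ‖ ‖L^{[n-1]}_{S⁻¹z} 𝟙‖`,
`‖L^{[n-1]}_{S⁻¹z} w‖ ≤ ‖w‖ ‖L^{[n-1]}_{S⁻¹z} 𝟙‖`, and hence
`‖L_z^{[n]} ξ‖ ≥ (α ‖ξ‖ / ‖w‖) ‖L^{[n-1]}_{S⁻¹z} w‖`. -/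
theorem Lpow_nonneg_vector_lower_bound
    (k l : ℕ) [NeZero k] [NeZero l] (hkl : k ≤ l)
    (p : Matrix (Fin k) (Fin k) ℝ) (q : Matrix (Fin k) (Fin l) ℝ)
    (hp_row : ∀ i, ∑ j, p i j = 1)
    (hq_row : ∀ i, ∑ m, q i m = 1)
    -- Hypothesis (H1)
    (hH1p : ∀ i j, 0 < p i j)
    (hH1q : ∀ i m, 0 < q i m)
    -- `α = (1/√k) min_{m ∈ B, i, j ∈ A} q(m|j) p(j|i)`
    (α : ℝ)
    (hα : α = (Real.sqrt k)⁻¹ *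
      Finset.univ.inf' Finset.univ_nonempty
        (fun x : Fin l × Fin k × Fin k => q x.2.2 x.1 * p x.2.1 x.2.2)) :
    0 < α ∧
    ∀ (z : ℤ → Fin l) (n : ℕ), 1 ≤ n →
      ∀ ξ : Fin k → ℝ, (∀ i, 0 ≤ ξ i) →
      ∀ w : Fin k → ℝ, w ≠ 0 →
        (enorm2 ((Lpow p q n z).mulVec ξ) ≥
          α * enorm2 ξ * enorm2 ((Lpow p q (n - 1) (invShift z)).mulVec fun _ => (1 : ℝ))) ∧
        (enorm2 ((Lpow p q (n - 1) (invShift z)).mulVec w) ≤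
          enorm2 w * enorm2 ((Lpow p q (n - 1) (invShift z)).mulVec fun _ => (1 : ℝ))) ∧
        (enorm2 ((Lpow p q n z).mulVec ξ) ≥
          (α * enorm2 ξ / enorm2 w) *
            enorm2 ((Lpow p q (n - 1) (invShift z)).mulVec w)) := by
  have hcpos : 0 < Finset.univ.inf' Finset.univ_nonempty
        (fun x : Fin l × Fin k × Fin k => q x.2.2 x.1 * p x.2.1 x.2.2) := by
    rw [Finset.lt_inf'_iff]
    exact fun x _ => mul_pos (hH1q _ _) (hH1p _ _)
  have hcle : ∀ m i j, Finset.univ.inf' Finset.univ_nonempty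
        (fun x : Fin l × Fin k × Fin k => q x.2.2 x.1 * p x.2.1 x.2.2) ≤ q j m * p i j :=
    fun m i j => Finset.inf'_le
      (fun x : Fin l × Fin k × Fin k => q x.2.2 x.1 * p x.2.1 x.2.2)
      (Finset.mem_univ (m, i, j))
  generalize Finset.univ.inf' Finset.univ_nonempty
        (fun x : Fin l × Fin k × Fin k => q x.2.2 x.1 * p x.2.1 x.2.2) = c at hα hcpos hcle
  have hk : (1 : ℝ) ≤ Real.sqrt k := by
    rw [Real.one_le_sqrt]
    exact_mod_cast Nat.one_le_iff_ne_zero.2 (NeZero.ne k)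
  have hαpos : 0 < α := by
    rw [hα]
    exact mul_pos (inv_pos.2 (by linarith)) hcpos
  have hαc : α ≤ c := by
    rw [hα]
    exact mul_le_of_le_one_left hcpos.le (inv_le_one_of_one_le₀ hk)
  refine ⟨hαpos, ?_⟩
  intro z n hn ξ hξ w hw
  obtain ⟨n, rfl⟩ : ∃ m, n = m + 1 := ⟨n - 1, by omega⟩
  rw [Nat.add_sub_cancel]
  have hM := aux_Lpow_nonneg p q hH1p hH1q n (invShift z)
  have h2 := aux_mulVec_bound _ hM w
  have hξ0 : 0 ≤ enorm2 ξ := Real.sqrt_nonneg _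
  have h1 : α * enorm2 ξ * enorm2 ((Lpow p q n (invShift z)).mulVec fun _ => (1 : ℝ)) ≤
      enorm2 ((Lpow p q (n + 1) z).mulVec ξ) := by
    rw [aux_Lpow_succ, ← Matrix.mulVec_mulVec]
    refine aux_mulVec_lower _ hM _ (mul_nonneg hαpos.le hξ0) _ fun i => ?_
    calc α * enorm2 ξ ≤ c * ∑ j, ξ j :=
          mul_le_mul hαc (aux_enorm2_le_sum ξ hξ) hξ0 hcpos.le
      _ = ∑ j, c * ξ j := Finset.mul_sum _ _ _
      _ ≤ _ := Finset.sum_le_sum fun j _ =>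
          mul_le_mul_of_nonneg_right (hcle (z 0) i j) (hξ j)
  refine ⟨h1, h2, ?_⟩
  have hw0 : 0 < enorm2 w := by
    obtain ⟨i, hi⟩ := Function.ne_iff.1 hw
    exact (abs_pos.2 hi).trans_le (aux_abs_le_enorm2 w i)
  refine le_trans ?_ h1
  rw [div_mul_eq_mul_div, div_le_iff₀ hw0, mul_assoc _ _ (enorm2 w), mul_comm _ (enorm2 w)]
  exact mul_le_mul_of_nonneg_left h2 (mul_nonneg hαpos.le hξ0)

end
end

section
/- Assume the matrix q has rank k, and fix symbols e_1, …, e_k ∈ B such that the k×k matrix M with entries M_{i,j} = q(e_i|j) is invertible. Then for every n ≥ 1, z ∈ B^ℤ, a ∈ A and b, c ∈ B: |Δ^{[n]}_{a,b,c}(z)| ≤ √k · ‖M^{−1}‖ · max_{e∈B} |Δ̃^{[n]}_{e,b,c}(z)|, where ‖M^{−1}‖ is the operator norm with respect to the Euclidean norm. -/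
open Filter MeasureTheory Matrix

noncomputable section

/-- `Δ̃^{[n]}_{e,b,c}(z) = Σ_{a∈A} q(e|a) Δ^{[n]}_{a,b,c}(z)`. -/
def Delt {k l : ℕ} (p : Matrix (Fin k) (Fin k) ℝ) (q : Matrix (Fin k) (Fin l) ℝ)
    (piv : Fin k → ℝ) (n : ℕ) (e b c : Fin l) (z : ℤ → Fin l) : ℝ :=
  ∑ a : Fin k, q a e * Del p q piv n a b c z

/-- `τ̃_z(e,b,c) = limsup_n (1/n) log |Δ̃^{[n]}_{e,b,c}(z)|`. -/
def taut {k l : ℕ} (p : Matrix (Fin k) (Fin k) ℝ) (q : Matrix (Fin k) (Fin l) ℝ)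
    (piv : Fin k → ℝ) (z : ℤ → Fin l) (e b c : Fin l) : ℝ :=
  Filter.limsup (fun n : ℕ => Real.log |Delt p q piv n e b c z| / n) Filter.atTop

/-- **Transfer inequality.** If `q` has rank `k` and `e₁,…,e_k ∈ B` are such that
`M = (q(e_i|j))_{i,j}` is invertible, then
`|Δ^{[n]}_{a,b,c}(z)| ≤ √k ‖M⁻¹‖ max_e |Δ̃^{[n]}_{e,b,c}(z)|`. -/
theorem hidden_delta_le_observed_delta
    (k l : ℕ) [NeZero k] [NeZero l] (hkl : k ≤ l)
    (p : Matrix (Fin k) (Fin k) ℝ) (q : Matrix (Fin k) (Fin l) ℝ)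
    (hp_nonneg : ∀ i j, 0 ≤ p i j) (hp_row : ∀ i, ∑ j, p i j = 1)
    (hq_nonneg : ∀ i m, 0 ≤ q i m) (hq_row : ∀ i, ∑ m, q i m = 1)
    (hq_rank : q.rank = k)
    (piv : Fin k → ℝ) (hpiv_nonneg : ∀ i, 0 ≤ piv i) (hpiv_sum : ∑ i, piv i = 1)
    (e : Fin k → Fin l)
    (M : Matrix (Fin k) (Fin k) ℝ)
    (hM : M = Matrix.of fun i j => q j (e i))
    (hMinv : IsUnit M)
    (n : ℕ) (hn : 1 ≤ n) (z : ℤ → Fin l) (a : Fin k) (b c : Fin l) :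
    |Del p q piv n a b c z| ≤
      Real.sqrt k * ‖(Matrix.toEuclideanLin M⁻¹).toContinuousLinearMap‖ *
        Finset.univ.sup' Finset.univ_nonempty
          (fun e' : Fin l => |Delt p q piv n e' b c z|) := by
  set D : Fin k → ℝ := fun a => Del p q piv n a b c z with hD
  set S := Finset.univ.sup' Finset.univ_nonempty
          (fun e' : Fin l => |Delt p q piv n e' b c z|) with hS
  have hle : ∀ e', |Delt p q piv n e' b c z| ≤ S := fun e' =>
    Finset.le_sup' (fun e' : Fin l => |Delt p q piv n e' b c z|) (Finset.mem_univ e')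
  have hS0 : 0 ≤ S := (abs_nonneg _).trans (hle b)
  set T := (Matrix.toEuclideanLin M⁻¹).toContinuousLinearMap with hT
  have hMD : M *ᵥ D = fun i => Delt p q piv n (e i) b c z := by
    funext i
    simp [hM, Matrix.mulVec, dotProduct, Delt, hD]
  have hdet : IsUnit M.det := (Matrix.isUnit_iff_isUnit_det M).1 hMinv
  have hTD : T (WithLp.toLp 2 (M *ᵥ D)) = WithLp.toLp 2 D := by
    simp [hT, Matrix.toLpLin_apply, Matrix.mulVec_mulVec, Matrix.nonsing_inv_mul M hdet]
  have h1 : |D a| ≤ ‖(WithLp.toLp 2 D : EuclideanSpace ℝ (Fin k))‖ := by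
    simpa using PiLp.norm_apply_le (WithLp.toLp 2 D : EuclideanSpace ℝ (Fin k)) a
  have h2 : ‖(WithLp.toLp 2 (M *ᵥ D) : EuclideanSpace ℝ (Fin k))‖ ≤ Real.sqrt k * S := by
    rw [EuclideanSpace.norm_eq]
    apply Real.sqrt_le_iff.2
    refine ⟨by positivity, ?_⟩
    rw [mul_pow, Real.sq_sqrt (Nat.cast_nonneg k)]
    calc _ ≤ ∑ i : Fin k, S ^ 2 := by
          apply Finset.sum_le_sum
          intro i _
          apply pow_le_pow_left₀ (norm_nonneg _)
          simpa [hMD] using hle (e i)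
      _ = _ := by simp
  calc |D a| ≤ ‖(WithLp.toLp 2 D : EuclideanSpace ℝ (Fin k))‖ := h1
    _ = ‖T (WithLp.toLp 2 (M *ᵥ D))‖ := by rw [hTD]
    _ ≤ ‖T‖ * ‖(WithLp.toLp 2 (M *ᵥ D) : EuclideanSpace ℝ (Fin k))‖ := T.le_opNorm _
    _ ≤ ‖T‖ * (Real.sqrt k * S) := by gcongr
    _ = Real.sqrt k * ‖T‖ * S := by ring

end
end

section
/- There exist ε0 > 0 and C > 0, depending only on p0, p1 and U, such that the following holds for every ε ∈ (0, ε0]: if ρ : {0,1}^ℤ → (0,∞) is a measurable function satisfying |ρ(z) − ⟨M_{z_1} e_{z_2}, e_{z_1}⟩/‖e_{z_1}‖²| ≤ U ε for all z, then |∫ log ρ dμ_ε − (π(0) H(p0) + π(1) H(p1))| ≤ C ε, where H(x) = x log x + (1−x) log(1−x). -/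
open Filter MeasureTheory Matrix

noncomputable section

/-- The inverse shift on binary sequences. -/
def invShift2 (z : ℤ → Fin 2) : ℤ → Fin 2 := fun n => z (n - 1)

/-- `η_0 = 1-ε`, `η_1 = ε`. -/
def eta (ε : ℝ) (b : Fin 2) : ℝ := if b = 0 then 1 - ε else ε

/-- The perturbed cocycle matrix `L_{z,ε}`. -/
def Lz (p0 p1 ε : ℝ) (z : ℤ → Fin 2) : Matrix (Fin 2) (Fin 2) ℝ :=
  !![eta ε (z 0) * p0, (1 - eta ε (z 0)) * (1 - p0);
     eta ε (z 0) * p1, (1 - eta ε (z 0)) * (1 - p1)]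

/-- The unperturbed matrices `M_b`. -/
def Mb (p0 p1 : ℝ) (b : Fin 2) : Matrix (Fin 2) (Fin 2) ℝ :=
  if b = 0 then !![p0, 0; p1, 0] else !![0, 1 - p0; 0, 1 - p1]

/-- The vectors `e_b`. -/
def eVec (p0 p1 : ℝ) (b : Fin 2) : Fin 2 → ℝ :=
  if b = 0 then ![p0, p1] else ![1 - p0, 1 - p1]

/-- The vectors `f_b` (orthogonal to the rows of `M_b`). -/
def fVec (p0 p1 : ℝ) (b : Fin 2) : Fin 2 → ℝ :=
  if b = 0 then ![-p1, p0] else ![-(1 - p1), 1 - p0]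

/-- The flip kernel `q_ε(w|x)`. -/
def qeps (ε : ℝ) (w x : Fin 2) : ℝ := if w = x then 1 - ε else ε

/-- `H(x) = x log x + (1-x) log (1-x)`. -/
def Hfun (x : ℝ) : ℝ := x * Real.log x + (1 - x) * Real.log (1 - x)

lemma aux_log (x y b d : ℝ) (hb : 0 < b) (hx : b / 2 ≤ x) (hy : b ≤ y) (h : |x - y| ≤ d) :
    |Real.log x - Real.log y| ≤ 2 / b * d := by
  have hx0 : 0 < x := by linarith
  have hy0 : 0 < y := by linarith
  have hd : 0 ≤ d := (abs_nonneg _).trans h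
  obtain ⟨h1, h2⟩ := abs_le.1 h
  have key : ∀ u v : ℝ, b / 2 ≤ u → 0 < v → v - u ≤ d → Real.log v - Real.log u ≤ 2 / b * d := by
    intro u v hu hv huv
    have hu0 : 0 < u := by linarith
    rw [← Real.log_div hv.ne' hu0.ne']
    have h3 := Real.log_le_sub_one_of_pos (div_pos hv hu0)
    have h4 : v / u - 1 = (v - u) / u := by field_simp
    have h5 : (v - u) / u ≤ d / u := by gcongr
    have h6 : d / u ≤ d / (b / 2) := by gcongr
    have h7 : d / (b / 2) = 2 / b * d := by field_simp
    linarith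
  rw [abs_le]
  constructor
  · have := key x y hx hy0 (by linarith)
    linarith
  · have := key y x (by linarith) hx0 (by linarith)
    linarith

lemma aux_mix (ε A B C D : ℝ) (h0 : 0 < ε) (h1 : ε ≤ 1) (hA : 0 ≤ A) (hA1 : A ≤ 1)
    (hB : 0 ≤ B) (hB1 : B ≤ 1) (hC : 0 ≤ C) (hC1 : C ≤ 1) (hD : 0 ≤ D) (hD1 : D ≤ 1)
    (m : ℝ) (hm : m = (1 - ε) * (1 - ε) * A + ε * (1 - ε) * (B + C) + ε * ε * D) :
    |m - A| ≤ 4 * ε := by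
  subst hm
  have e1 : 0 ≤ ε * (1 - ε) := mul_nonneg h0.le (by linarith)
  have e2 : 0 ≤ ε * ε := by positivity
  have e3 : ε * ε ≤ ε := by nlinarith
  have b1 : ε * (1 - ε) * (B + C) ≤ ε * (1 - ε) * 2 :=
    mul_le_mul_of_nonneg_left (by linarith) e1
  have b2 : 0 ≤ ε * (1 - ε) * (B + C) := mul_nonneg e1 (by linarith)
  have b3 : ε * ε * D ≤ ε * ε * 1 := mul_le_mul_of_nonneg_left hD1 e2
  have b4 : 0 ≤ ε * ε * D := mul_nonneg e2 hD
  have b5 : (2 * ε - ε * ε) * A ≤ (2 * ε - ε * ε) * 1 :=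
    mul_le_mul_of_nonneg_left hA1 (by linarith)
  have b6 : 0 ≤ (2 * ε - ε * ε) * A := mul_nonneg (by linarith) hA
  rw [abs_le]
  constructor <;> nlinarith

lemma aux_int (μ : Measure (ℤ → Fin 2)) [IsProbabilityMeasure μ] (g : Fin 2 → Fin 2 → ℝ) :
    Integrable (fun z : ℤ → Fin 2 => g (z 1) (z 2)) μ ∧
    ∫ z, g (z 1) (z 2) ∂μ = ∑ a, ∑ b, μ.real {z | z 1 = a ∧ z 2 = b} * g a b := by
  have hm : Measurable (fun z : ℤ → Fin 2 => (z 1, z 2)) := by fun_prop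
  have hg : Measurable (fun x : Fin 2 × Fin 2 => g x.1 x.2) := measurable_of_finite _
  haveI : IsProbabilityMeasure (μ.map (fun z : ℤ → Fin 2 => (z 1, z 2))) :=
    Measure.isProbabilityMeasure_map hm.aemeasurable
  have hint : Integrable (fun x : Fin 2 × Fin 2 => g x.1 x.2)
      (μ.map (fun z : ℤ → Fin 2 => (z 1, z 2))) := Integrable.of_finite
  refine ⟨hint.comp_measurable hm, ?_⟩
  have h1 := integral_map (μ := μ) hm.aemeasurable (f := fun x : Fin 2 × Fin 2 => g x.1 x.2)
    hg.aestronglyMeasurable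
  simp only at h1
  rw [← h1, integral_fintype hint, Fintype.sum_prod_type]
  refine Finset.sum_congr rfl fun a _ => Finset.sum_congr rfl fun b _ => ?_
  rw [map_measureReal_apply hm (measurableSet_singleton _), smul_eq_mul]
  congr 2
  ext z
  simp

lemma aux_ratio (p0 p1 : ℝ) (hp0 : p0 ∈ Set.Ioo (0 : ℝ) 1) (a b : Fin 2) :
    dotProduct ((Mb p0 p1 a).mulVec (eVec p0 p1 b)) (eVec p0 p1 a) /
      (enorm2 (eVec p0 p1 a)) ^ 2 = !![p0, 1 - p0; p1, 1 - p1] a b := by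
  obtain ⟨h0, h1⟩ := hp0
  have hs : ∀ x y : ℝ, Real.sqrt (x ^ 2 + y ^ 2) ^ 2 = x ^ 2 + y ^ 2 := fun x y =>
    Real.sq_sqrt (by positivity)
  have n0 : p0 ^ 2 + p1 ^ 2 ≠ 0 := by positivity
  have h1' : 0 < 1 - p0 := by linarith
  have n1 : (1 - p0) ^ 2 + (1 - p1) ^ 2 ≠ 0 := by positivity
  fin_cases a <;> fin_cases b <;>
    simp [Mb, eVec, enorm2, hs, Matrix.mulVec, dotProduct, Fin.sum_univ_two] <;>
    rw [div_eq_iff (by assumption)] <;> ring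

/-- **First-order expansion of `∫ log ρ dμ_ε`.** There are `ε₀ > 0` and `C > 0`,
depending only on `p0`, `p1`, `U`, such that for all `ε ∈ (0,ε₀]`, any probability
measure `μ_ε` with the stated two-coordinate marginal and any measurable positive `ρ`
that is `Uε`-close to `⟨M_{z₁} e_{z₂}, e_{z₁}⟩/‖e_{z₁}‖²`, one has
`|∫ log ρ dμ_ε − (π(0)H(p0) + π(1)H(p1))| ≤ Cε`. -/
theorem integral_log_rho_expansion
    (p0 p1 : ℝ) (hp0 : p0 ∈ Set.Ioo (0 : ℝ) 1) (hp1 : p1 ∈ Set.Ioo (0 : ℝ) 1)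
    (hne : p0 ≠ p1)
    (P : Matrix (Fin 2) (Fin 2) ℝ) (hP : P = !![p0, 1 - p0; p1, 1 - p1])
    (piv : Fin 2 → ℝ)
    (hpiv_nonneg : ∀ i, 0 ≤ piv i) (hpiv_sum : piv 0 + piv 1 = 1)
    (hpiv_inv : ∀ j, piv 0 * P 0 j + piv 1 * P 1 j = piv j)
    (U : ℝ) (hU : 1 < U) :
    ∃ ε0 > (0 : ℝ), ∃ C > (0 : ℝ),
      ∀ ε : ℝ, 0 < ε → ε ≤ ε0 →
      ∀ μ : MeasureTheory.Measure (ℤ → Fin 2), MeasureTheory.IsProbabilityMeasure μ →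
        (∀ w1 w2 : Fin 2,
          μ {z | z 1 = w1 ∧ z 2 = w2} =
            ENNReal.ofReal
              (∑ x1 : Fin 2, ∑ x2 : Fin 2,
                piv x1 * qeps ε w1 x1 * P x1 x2 * qeps ε w2 x2)) →
      ∀ ρ : (ℤ → Fin 2) → ℝ, Measurable ρ → (∀ z, 0 < ρ z) →
        (∀ z : ℤ → Fin 2,
          |ρ z -
              dotProduct ((Mb p0 p1 (z 1)).mulVec (eVec p0 p1 (z 2))) (eVec p0 p1 (z 1)) /
                (enorm2 (eVec p0 p1 (z 1))) ^ 2| ≤ U * ε) →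
        |(∫ z, Real.log (ρ z) ∂μ) - (piv 0 * Hfun p0 + piv 1 * Hfun p1)| ≤ C * ε := by
  have hP0 : ∀ a b, 0 < P a b := by
    obtain ⟨h0, h1⟩ := hp0
    obtain ⟨h2, h3⟩ := hp1
    subst hP
    intro a b
    fin_cases a <;> fin_cases b <;> simp <;> linarith
  have hP1 : ∀ a b, P a b ≤ 1 := by
    obtain ⟨h0, h1⟩ := hp0
    obtain ⟨h2, h3⟩ := hp1
    subst hP
    intro a b
    fin_cases a <;> fin_cases b <;> simp <;> linarith
  have hpiv1 : ∀ a, piv a ≤ 1 := by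
    have h0 := hpiv_nonneg 0
    have h1 := hpiv_nonneg 1
    intro a
    fin_cases a <;> simp <;> linarith
  have hA0 : ∀ a b, 0 ≤ piv a * P a b := fun a b => mul_nonneg (hpiv_nonneg a) (hP0 a b).le
  have hA1 : ∀ a b, piv a * P a b ≤ 1 := fun a b =>
    mul_le_one₀ (hpiv1 a) (hP0 a b).le (hP1 a b)
  obtain ⟨β, hβ, hβP⟩ : ∃ β > (0 : ℝ), ∀ a b, β ≤ P a b := by
    refine ⟨min (min (P 0 0) (P 0 1)) (min (P 1 0) (P 1 1)), ?_, ?_⟩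
    · simp [hP0]
    · intro a b
      fin_cases a <;> fin_cases b <;> simp
  have hU0 : 0 < U := by linarith
  refine ⟨min 1 (β / (2 * U)), by positivity,
    2 / β * U + 4 * ∑ a, ∑ b, |Real.log (P a b)|, by positivity, ?_⟩
  intro ε hε hε0 μ hμ hmarg ρ hρm hρpos hρ
  have hε1 : ε ≤ 1 := hε0.trans (min_le_left _ _)
  have hεU : U * ε ≤ β / 2 := by
    have := hε0.trans (min_le_right _ _)
    rw [le_div_iff₀ (by positivity)] at this
    linarith
  have hclose : ∀ z, |Real.log (ρ z) - Real.log (P (z 1) (z 2))| ≤ 2 / β * (U * ε) := by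
    intro z
    have h := hρ z
    rw [aux_ratio p0 p1 hp0, ← hP] at h
    have hb := hβP (z 1) (z 2)
    have := (abs_le.1 h).1
    exact aux_log _ _ β _ hβ (by linarith) hb h
  obtain ⟨hgi, hg⟩ := aux_int μ (fun a b => Real.log (P a b))
  have hdi : Integrable (fun z => Real.log (ρ z) - Real.log (P (z 1) (z 2))) μ := by
    refine Integrable.of_bound ?_ (2 / β * (U * ε)) (Eventually.of_forall hclose)
    exact (Real.measurable_log.comp hρm).aestronglyMeasurable.sub hgi.aestronglyMeasurable
  have hsplit : ∫ z, Real.log (ρ z) ∂μ =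
      (∫ z, (Real.log (ρ z) - Real.log (P (z 1) (z 2))) ∂μ) +
        ∫ z, Real.log (P (z 1) (z 2)) ∂μ := by
    rw [← integral_add hdi hgi]
    simp
  have hI1 : |∫ z, (Real.log (ρ z) - Real.log (P (z 1) (z 2))) ∂μ| ≤ 2 / β * (U * ε) := by
    have := norm_integral_le_of_norm_le_const (μ := μ)
      (f := fun z => Real.log (ρ z) - Real.log (P (z 1) (z 2))) (Eventually.of_forall hclose)
    simpa using this
  have hent : piv 0 * Hfun p0 + piv 1 * Hfun p1 =
      ∑ a, ∑ b, piv a * P a b * Real.log (P a b) := by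
    subst hP
    simp [Fin.sum_univ_two, Hfun]
    ring
  have hm : ∀ a b, |μ.real {z | z 1 = a ∧ z 2 = b} - piv a * P a b| ≤ 4 * ε := by
    intro a b
    have hq : ∀ w x, 0 ≤ qeps ε w x := by
      intro w x
      unfold qeps
      split_ifs <;> linarith
    have hnn : 0 ≤ ∑ x1 : Fin 2, ∑ x2 : Fin 2,
        piv x1 * qeps ε a x1 * P x1 x2 * qeps ε b x2 :=
      Finset.sum_nonneg fun x _ => Finset.sum_nonneg fun y _ =>
        mul_nonneg (mul_nonneg (mul_nonneg (hpiv_nonneg x) (hq _ _)) (hP0 x y).le) (hq _ _)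
    rw [Measure.real, hmarg, ENNReal.toReal_ofReal hnn]
    apply aux_mix ε (piv a * P a b) (piv a * P a (1 - b)) (piv (1 - a) * P (1 - a) b)
      (piv (1 - a) * P (1 - a) (1 - b)) hε hε1 (hA0 _ _) (hA1 _ _) (hA0 _ _) (hA1 _ _)
      (hA0 _ _) (hA1 _ _) (hA0 _ _) (hA1 _ _)
    fin_cases a <;> fin_cases b <;> simp [qeps, Fin.sum_univ_two] <;> ring
  have hI2 : |(∫ z, Real.log (P (z 1) (z 2)) ∂μ) - (piv 0 * Hfun p0 + piv 1 * Hfun p1)| ≤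
      4 * ε * ∑ a, ∑ b, |Real.log (P a b)| := by
    rw [hg, hent, ← Finset.sum_sub_distrib, Finset.mul_sum]
    refine (Finset.abs_sum_le_sum_abs _ _).trans (Finset.sum_le_sum fun a _ => ?_)
    rw [← Finset.sum_sub_distrib, Finset.mul_sum]
    refine (Finset.abs_sum_le_sum_abs _ _).trans (Finset.sum_le_sum fun b _ => ?_)
    rw [← sub_mul, abs_mul]
    exact mul_le_mul_of_nonneg_right (hm a b) (abs_nonneg _)
  rw [hsplit, add_sub_assoc]
  refine (abs_add_le _ _).trans ((add_le_add hI1 hI2).trans (le_of_eq ?_))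
  ring

end
end
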